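/- Under the assumptions N ≥ 2, p̄ < p < 4*, a, μ > 0 and μ^{pγ_p−2}a^{p−2} < C̃(N,p), the local minimum value m(a,μ) = inf{E_μ(u) : ||u||_2 = a, ||Δu||_2 < R₀} satisfies −∞ < m(a,μ) < 0. -/

import Mathlib

open MeasureTheory Filter Topology

noncomputable def lapl {N : ℕ} (u : EuclideanSpace ℝ (Fin N) → ℝ)
    (x : EuclideanSpace ℝ (Fin N)) : ℝ :=
  ∑ i : Fin N, iteratedFDeriv ℝ 2 u x ![EuclideanSpace.single i 1, EuclideanSpace.single i 1]

noncomputable def Emu {N : ℕ} (μ p : ℝ) (v : EuclideanSpace ℝ (Fin N) → ℝ) : ℝ :=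
  1 / 2 * (∫ x, (lapl v x) ^ 2) - μ / 2 * (∫ x, ‖gradient v x‖ ^ 2) - 1 / p * (∫ x, |v x| ^ p)

noncomputable def Vset (N : ℕ) (a μ p R₀ : ℝ) : Set ℝ :=
  {c | ∃ v : EuclideanSpace ℝ (Fin N) → ℝ, ContDiff ℝ 2 v ∧
    Integrable (fun x => (v x) ^ 2) ∧ Integrable (fun x => ‖gradient v x‖ ^ 2) ∧
    Integrable (fun x => (lapl v x) ^ 2) ∧ Integrable (fun x => |v x| ^ p) ∧
    (∫ x, (v x) ^ 2) = a ^ 2 ∧ Real.sqrt (∫ x, (lapl v x) ^ 2) < R₀ ∧ c = Emu μ p v}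

section

variable {N : ℕ}

local notation "E" => EuclideanSpace ℝ (Fin N)

theorem norm_gradient_eq_norm_fderiv (v : E → ℝ) (x : E) :
    ‖gradient v x‖ = ‖fderiv ℝ v x‖ := by
  rw [← toDual_gradient, LinearIsometryEquiv.norm_map]

theorem norm_gradient_sq (v : E → ℝ) (x : E) :
    ‖gradient v x‖ ^ 2 = ∑ i, fderiv ℝ v x (EuclideanSpace.single i 1) ^ 2 := by
  rw [EuclideanSpace.real_norm_sq_eq]
  refine Finset.sum_congr rfl fun i _ => ?_
  rw [← inner_gradient_left, EuclideanSpace.inner_single_right]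
  simp

theorem lapl_eq_sum_fderiv {v : E → ℝ} (hv : ContDiff ℝ 2 v) (x : E) :
    lapl v x = ∑ i, fderiv ℝ (fun y => fderiv ℝ v y (EuclideanSpace.single i 1)) x
      (EuclideanSpace.single i 1) := by
  have hd : DifferentiableAt ℝ (fderiv ℝ v) x :=
    (hv.fderiv_right (m := 1) (by norm_num)).differentiable (by norm_num) x
  refine Finset.sum_congr rfl fun i _ => ?_
  rw [iteratedFDeriv_two_apply, fderiv_clm_apply hd (differentiableAt_const _)]
  simp

theorem continuous_lapl {v : E → ℝ} (hv : ContDiff ℝ 2 v) : Continuous (lapl v) := by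
  have h := hv.continuous_iteratedFDeriv (m := 2) le_rfl
  unfold lapl
  fun_prop

theorem continuous_norm_gradient {v : E → ℝ} (hv : ContDiff ℝ 2 v) :
    Continuous fun x => ‖gradient v x‖ := by
  simp_rw [norm_gradient_eq_norm_fderiv]
  exact (hv.continuous_fderiv (by norm_num)).norm

theorem HasCompactSupport.sq {v : E → ℝ} (hv : HasCompactSupport v) :
    HasCompactSupport fun x => v x ^ 2 :=
  hv.comp_left (g := fun s => s ^ 2) (by simp)

theorem HasCompactSupport.lapl {v : E → ℝ} (hv : HasCompactSupport v) :
    HasCompactSupport (lapl v) := by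
  refine (hv.iteratedFDeriv (𝕜 := ℝ) 2).mono fun x hx h => hx ?_
  simp [_root_.lapl, Function.notMem_support.mp (not_not.mpr h)]

theorem HasCompactSupport.norm_gradient {v : E → ℝ} (hv : HasCompactSupport v) :
    HasCompactSupport fun x => ‖gradient v x‖ := by
  simp_rw [norm_gradient_eq_norm_fderiv]
  exact (hv.fderiv (𝕜 := ℝ)).norm

theorem integrable_mul_lapl {v : E → ℝ} (hv : ContDiff ℝ 2 v)
    (h0 : Integrable fun x => v x ^ 2) (h2 : Integrable fun x => lapl v x ^ 2) :
    Integrable fun x => v x * lapl v x :=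
  ((memLp_two_iff_integrable_sq hv.continuous.aestronglyMeasurable).mpr h0).integrable_mul
    ((memLp_two_iff_integrable_sq (continuous_lapl hv).aestronglyMeasurable).mpr h2)

/-- Integration by parts against a compactly supported cutoff. -/
theorem integral_cutoff_mul_norm_gradient_sq_add {v χ : E → ℝ} (hv : ContDiff ℝ 2 v)
    (hχ : ContDiff ℝ 1 χ) (hχc : HasCompactSupport χ) :
    ∫ x, χ x * (‖gradient v x‖ ^ 2 + v x * lapl v x) =
      -∫ x, v x * ∑ i, fderiv ℝ v x (EuclideanSpace.single i 1) *
        fderiv ℝ χ x (EuclideanSpace.single i 1) := by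
  set e : Fin N → E := fun i => EuclideanSpace.single i 1
  have hw : ∀ i, ContDiff ℝ 1 fun y => fderiv ℝ v y (e i) := fun i =>
    (hv.fderiv_right (m := 1) (by norm_num)).clm_apply contDiff_const
  have hw' : ∀ i, Continuous fun y => fderiv ℝ (fun y => fderiv ℝ v y (e i)) y (e i) := fun i =>
    ((hw i).continuous_fderiv (by norm_num)).clm_apply continuous_const
  have hχ' : ∀ i, Continuous fun y => fderiv ℝ χ y (e i) := fun i =>
    (hχ.continuous_fderiv (by norm_num)).clm_apply continuous_const
  have hvd : Differentiable ℝ v := hv.differentiable (by norm_num)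
  have hχd : Differentiable ℝ χ := hχ.differentiable (by norm_num)
  have hχv : HasCompactSupport fun x => χ x * v x := hχc.mul_right
  have hprod : ∀ i x, fderiv ℝ (fun x => χ x * v x) x (e i) =
      χ x * fderiv ℝ v x (e i) + v x * fderiv ℝ χ x (e i) := fun i x => by
    rw [fderiv_fun_mul (hχd x) (hvd x)]
    simp
  have hA : ∀ i, Integrable fun x => fderiv ℝ (fun y => fderiv ℝ v y (e i)) x (e i) *
      (χ x * v x) := fun i =>
    ((hw' i).mul (hχ.continuous.mul hv.continuous)).integrable_of_hasCompactSupport hχv.mul_left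
  have hB1 : ∀ i, Integrable fun x => χ x * fderiv ℝ v x (e i) ^ 2 := fun i =>
    (hχ.continuous.mul ((hw i).continuous.pow 2)).integrable_of_hasCompactSupport hχc.mul_right
  have hB2 : ∀ i, Integrable fun x => v x * (fderiv ℝ v x (e i) * fderiv ℝ χ x (e i)) := fun i =>
    (hv.continuous.mul ((hw i).continuous.mul (hχ' i))).integrable_of_hasCompactSupport
      (hχc.fderiv_apply (𝕜 := ℝ) (e i)).mul_left.mul_left
  have hBeq : ∀ i, (fun x => fderiv ℝ v x (e i) * fderiv ℝ (fun x => χ x * v x) x (e i)) =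
      fun x => χ x * fderiv ℝ v x (e i) ^ 2 +
        v x * (fderiv ℝ v x (e i) * fderiv ℝ χ x (e i)) := fun i => by
    funext x
    rw [hprod]
    ring
  have hi : ∀ i, ∫ x, (χ x * fderiv ℝ v x (e i) ^ 2 +
        fderiv ℝ (fun y => fderiv ℝ v y (e i)) x (e i) * (χ x * v x)) =
      -∫ x, v x * (fderiv ℝ v x (e i) * fderiv ℝ χ x (e i)) := fun i => by
    have h := integral_mul_fderiv_eq_neg_fderiv_mul_of_integrable (μ := volume)
      (f := fun y => fderiv ℝ v y (e i)) (g := fun x => χ x * v x) (v := e i) (hA i)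
      (by rw [hBeq]; exact (hB1 i).add (hB2 i))
      (((hw i).continuous.mul (hχ.continuous.mul hv.continuous)).integrable_of_hasCompactSupport
        hχv.mul_left)
      (fun x _ => (hw i).differentiable (by norm_num) x) (fun x _ => (hχd.mul hvd) x)
    rw [hBeq, integral_add (hB1 i) (hB2 i)] at h
    rw [integral_add (hB1 i) (hA i)]
    linarith
  simp_rw [Finset.mul_sum]
  rw [integral_finsetSum _ fun i _ => hB2 i, ← Finset.sum_neg_distrib,
    ← Finset.sum_congr rfl fun i _ => hi i,
    ← integral_finsetSum (f := fun i x => χ x * fderiv ℝ v x (e i) ^ 2 +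
      fderiv ℝ (fun y => fderiv ℝ v y (e i)) x (e i) * (χ x * v x)) _
      fun i _ => (hB1 i).add (hA i)]
  refine integral_congr_ae (Eventually.of_forall fun x => ?_)
  simp only [norm_gradient_sq, lapl_eq_sum_fderiv hv, Finset.sum_add_distrib, ← Finset.mul_sum,
    ← Finset.sum_mul]
  ring

/-- Green's identity on the whole space. -/
theorem integral_norm_gradient_sq_add_mul_lapl {v : E → ℝ} (hv : ContDiff ℝ 2 v)
    (h0 : Integrable fun x => v x ^ 2) (h1 : Integrable fun x => ‖gradient v x‖ ^ 2)
    (h2 : Integrable fun x => lapl v x ^ 2) :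
    ∫ x, (‖gradient v x‖ ^ 2 + v x * lapl v x) = 0 := by
  let χ : ContDiffBump (0 : E) := ⟨1, 2, one_pos, one_lt_two⟩
  have hχ : ContDiff ℝ 1 χ := χ.contDiff
  let c : ℕ → ℝ := fun n => 1 / ((n : ℝ) + 1)
  have hc0 : ∀ n, 0 < c n := fun n => by positivity
  have hct : Tendsto c atTop (𝓝 0) := tendsto_one_div_add_atTop_nhds_zero_nat
  let ξ : ℕ → E → ℝ := fun n x => χ (c n • x)
  have hξ : ∀ n, ContDiff ℝ 1 (ξ n) := fun n => hχ.comp (contDiff_const_smul (c n))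
  have hξc : ∀ n, HasCompactSupport (ξ n) := fun n => χ.hasCompactSupport.comp_smul (hc0 n).ne'
  have hξ' : ∀ n x, fderiv ℝ (ξ n) x = c n • fderiv ℝ χ (c n • x) := fun n x =>
    fderiv_comp_smul (c n)
  obtain ⟨M, hM⟩ := (hχ.continuous_fderiv (by norm_num)).bounded_above_of_compact_support
    (χ.hasCompactSupport.fderiv (𝕜 := ℝ))
  have hM0 : 0 ≤ M := (norm_nonneg _).trans (hM 0)
  have hvl := integrable_mul_lapl hv h0 h2
  have hint : Integrable fun x => ‖gradient v x‖ ^ 2 + v x * lapl v x := h1.add hvl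
  have hlim1 : Tendsto (fun n => ∫ x, ξ n x * (‖gradient v x‖ ^ 2 + v x * lapl v x)) atTop
      (𝓝 (∫ x, (‖gradient v x‖ ^ 2 + v x * lapl v x))) := by
    refine tendsto_integral_of_dominated_convergence _
      (fun n => (hξ n).continuous.aestronglyMeasurable.mul hint.1) hint.norm
      (fun n => Eventually.of_forall fun x => ?_) (Eventually.of_forall fun x => ?_)
    · rw [norm_mul, Real.norm_of_nonneg χ.nonneg]
      exact mul_le_of_le_one_left (norm_nonneg _) χ.le_one
    · have : Tendsto (fun n => ξ n x) atTop (𝓝 (χ ((0 : ℝ) • x))) :=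
        (χ.continuous.tendsto _).comp (hct.smul_const x)
      rw [zero_smul, χ.one_of_mem_closedBall (by simp [χ])] at this
      simpa using this.mul_const (‖gradient v x‖ ^ 2 + v x * lapl v x)
  have hsum : ∀ n x, ‖∑ i, fderiv ℝ v x (EuclideanSpace.single i 1) *
      fderiv ℝ (ξ n) x (EuclideanSpace.single i 1)‖ ≤ c n * (N * (M * ‖gradient v x‖)) := by
    intro n x
    refine (norm_sum_le _ _).trans ?_
    have hle : ∀ i ∈ Finset.univ, ‖fderiv ℝ v x (EuclideanSpace.single i 1) *
        fderiv ℝ (ξ n) x (EuclideanSpace.single i 1)‖ ≤ c n * (M * ‖gradient v x‖) := by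
      intro i _
      have ha := (fderiv ℝ v x).le_opNorm (EuclideanSpace.single i 1)
      have hb := (fderiv ℝ χ (c n • x)).le_opNorm (EuclideanSpace.single i 1)
      rw [PiLp.norm_single, norm_one, mul_one] at ha hb
      rw [hξ', smul_apply, norm_mul, norm_smul, Real.norm_of_nonneg (hc0 n).le,
        norm_gradient_eq_norm_fderiv]
      calc _ ≤ ‖fderiv ℝ v x‖ * (c n * M) :=
            mul_le_mul ha (mul_le_mul_of_nonneg_left (hb.trans (hM _)) (hc0 n).le)
              (mul_nonneg (hc0 n).le (norm_nonneg _)) (norm_nonneg _)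
        _ = _ := by ring
    refine (Finset.sum_le_sum hle).trans (le_of_eq ?_)
    simp
    ring
  have hbound : ∀ n x, ‖v x * ∑ i, fderiv ℝ v x (EuclideanSpace.single i 1) *
      fderiv ℝ (ξ n) x (EuclideanSpace.single i 1)‖ ≤
      c n * (N * M * (v x ^ 2 + ‖gradient v x‖ ^ 2)) := by
    intro n x
    rw [norm_mul]
    refine (mul_le_mul_of_nonneg_left (hsum n x) (norm_nonneg _)).trans ?_
    have hy : ‖v x‖ * ‖gradient v x‖ ≤ v x ^ 2 + ‖gradient v x‖ ^ 2 := by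
      rw [Real.norm_eq_abs, ← sq_abs (v x)]
      nlinarith [sq_nonneg (|v x| - ‖gradient v x‖), sq_nonneg |v x|, sq_nonneg ‖gradient v x‖]
    calc _ = c n * (N * M * (‖v x‖ * ‖gradient v x‖)) := by ring
      _ ≤ _ := mul_le_mul_of_nonneg_left (mul_le_mul_of_nonneg_left hy (by positivity)) (hc0 n).le
  have hlim2 : Tendsto (fun n => ∫ x, v x * ∑ i, fderiv ℝ v x (EuclideanSpace.single i 1) *
      fderiv ℝ (ξ n) x (EuclideanSpace.single i 1)) atTop (𝓝 0) := by
    refine squeeze_zero_norm (a := fun n => c n * ∫ x, N * M * (v x ^ 2 + ‖gradient v x‖ ^ 2))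
      (fun n => ?_) (by simpa using hct.mul_const _)
    rw [← integral_const_mul]
    exact norm_integral_le_of_norm_le (((h0.add h1).const_mul _).const_mul _)
      (Eventually.of_forall fun x => hbound n x)
  refine tendsto_nhds_unique hlim1 ?_
  simp_rw [integral_cutoff_mul_norm_gradient_sq_add hv (hξ _) (hξc _)]
  simpa using hlim2.neg

theorem integral_norm_gradient_sq_le {v : E → ℝ} (hv : ContDiff ℝ 2 v)
    (h0 : Integrable fun x => v x ^ 2) (h1 : Integrable fun x => ‖gradient v x‖ ^ 2)
    (h2 : Integrable fun x => lapl v x ^ 2) :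
    ∫ x, ‖gradient v x‖ ^ 2 ≤ (∫ x, v x ^ 2) + ∫ x, lapl v x ^ 2 := by
  have h := integral_norm_gradient_sq_add_mul_lapl hv h0 h1 h2
  have hvl := integrable_mul_lapl hv h0 h2
  have hmono : ∫ x, ‖gradient v x‖ ^ 2 ≤
      ∫ x, ((‖gradient v x‖ ^ 2 + v x * lapl v x) + (v x ^ 2 + lapl v x ^ 2)) := by
    refine integral_mono h1 ((h1.add hvl).add (h0.add h2)) fun x => ?_
    have := sq_nonneg (v x + lapl v x)
    have := sq_nonneg (v x)
    have := sq_nonneg (lapl v x)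
    nlinarith
  have hadd := integral_add (h1.add hvl) (h0.add h2)
  simp only [Pi.add_apply] at hadd
  rw [hadd, h, zero_add, integral_add h0 h2] at hmono
  exact hmono

theorem fderiv_const_mul_comp_smul {u : E → ℝ} (hu : Differentiable ℝ u) (k t : ℝ) (x : E) :
    fderiv ℝ (fun y => k * u (t • y)) x = (k * t) • fderiv ℝ u (t • x) := by
  have hd : DifferentiableAt ℝ (fun y => u (t • y)) x :=
    (hu (t • x)).comp x (differentiableAt_id.const_smul t)
  rw [fderiv_const_mul hd, fderiv_comp_smul, smul_smul]

theorem lapl_const_mul_comp_smul {u : E → ℝ} (hu : ContDiff ℝ 2 u) (k t : ℝ) (x : E) :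
    lapl (fun y => k * u (t • y)) x = k * t ^ 2 * lapl u (t • x) := by
  have hd : Differentiable ℝ (fderiv ℝ u) :=
    (hu.fderiv_right (m := 1) (by norm_num)).differentiable (by norm_num)
  have h1 : fderiv ℝ (fun y => k * u (t • y)) = fun y => (k * t) • fderiv ℝ u (t • y) :=
    funext fun y => fderiv_const_mul_comp_smul (hu.differentiable (by norm_num)) k t y
  have h2 : fderiv ℝ (fderiv ℝ fun y => k * u (t • y)) x =
      (k * t ^ 2) • fderiv ℝ (fderiv ℝ u) (t • x) := by
    have hd' : DifferentiableAt ℝ (fun y => fderiv ℝ u (t • y)) x :=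
      (hd (t • x)).comp x (differentiableAt_id.const_smul t)
    rw [h1, fderiv_fun_const_smul hd', fderiv_comp_smul, smul_smul]
    ring_nf
  simp only [lapl, iteratedFDeriv_two_apply, h2, smul_apply, smul_eq_mul, Finset.mul_sum]

theorem integral_norm_gradient_sq_pos {u : E → ℝ} (hN : N ≠ 0) (hu : ContDiff ℝ 2 u)
    (huc : HasCompactSupport u) (hu0 : u 0 ≠ 0) : 0 < ∫ x, ‖gradient u x‖ ^ 2 := by
  obtain ⟨x, hx⟩ : ∃ x, fderiv ℝ u x ≠ 0 := by
    by_contra! h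
    have hconst := is_const_of_fderiv_eq_zero (hu.differentiable (by norm_num)) h
    have : NeZero N := ⟨hN⟩
    have : NoncompactSpace E := NormedSpace.noncompactSpace ℝ E
    obtain ⟨y, hy⟩ : ∃ y, y ∉ tsupport u := by
      by_contra! h'
      exact noncompact_univ E (Set.eq_univ_of_forall h' ▸ huc)
    exact hu0 ((hconst 0 y).trans (image_eq_zero_of_notMem_tsupport hy))
  refine ((continuous_norm_gradient hu).pow 2).integral_pos_of_hasCompactSupport_nonneg_nonzero
    (x := x) ?_ (fun y => by positivity) ?_
  · exact huc.norm_gradient.sq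
  · rw [norm_gradient_eq_norm_fderiv]
    exact pow_ne_zero 2 (norm_ne_zero_iff.mpr hx)

/-- Spreading out a bump at fixed mass makes its energy negative. -/
theorem exists_mem_Vset_neg (hN : N ≠ 0) {a μ p R₀ : ℝ} (ha : 0 < a) (hμ : 0 < μ) (hp : 0 < p)
    (hR₀ : 0 < R₀) : ∃ c ∈ Vset N a μ p R₀, c < 0 := by
  let χ : ContDiffBump (0 : E) := ⟨1, 2, one_pos, one_lt_two⟩
  let u : E → ℝ := χ
  have hu : ContDiff ℝ 2 u := χ.contDiff
  have huc : HasCompactSupport u := χ.hasCompactSupport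
  have hu0 : u 0 ≠ 0 := (χ.pos_of_mem_ball (by simp [χ])).ne'
  set I := ∫ x, u x ^ 2 with hI
  set B := ∫ x, ‖gradient u x‖ ^ 2 with hB
  set A := ∫ x, lapl u x ^ 2 with hA
  have hIpos : 0 < I := by
    refine (hu.continuous.pow 2).integral_pos_of_hasCompactSupport_nonneg_nonzero
      (x := 0) ?_ (fun y => by positivity) (pow_ne_zero 2 hu0)
    exact huc.sq
  have hBpos : 0 < B := integral_norm_gradient_sq_pos hN hu huc hu0
  obtain ⟨t, ht, ht1, ht2⟩ : ∃ t : ℝ, 0 < t ∧ √(a ^ 2 / I * t ^ 4 * A) < R₀ ∧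
      t ^ 2 * A < μ * B := by
    have hc1 : ContinuousAt (fun t : ℝ => √(a ^ 2 / I * t ^ 4 * A)) 0 := by fun_prop
    have hc2 : ContinuousAt (fun t : ℝ => t ^ 2 * A) 0 := by fun_prop
    have e1 := hc1.tendsto.eventually_lt_const (u := R₀) (by simpa using hR₀)
    have e2 := hc2.tendsto.eventually_lt_const (u := μ * B) (by simpa using mul_pos hμ hBpos)
    obtain ⟨t, h, ht⟩ := (((e1.and e2).filter_mono nhdsWithin_le_nhds).and
      (self_mem_nhdsWithin (s := Set.Ioi (0 : ℝ)))).exists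
    exact ⟨t, ht, h⟩
  let k := √(a ^ 2 / I * t ^ N)
  have hk : k ^ 2 = a ^ 2 / I * t ^ N := Real.sq_sqrt (by positivity)
  let v : E → ℝ := fun y => k * u (t • y)
  have hv : ContDiff ℝ 2 v := contDiff_const.mul (hu.comp (contDiff_const_smul t))
  have hvc : HasCompactSupport v := (huc.comp_smul ht.ne').mul_left
  have hscale : ∀ (g : E → ℝ) (b : ℝ), ∫ x, k ^ 2 * b * g (t • x) = a ^ 2 / I * b * ∫ x, g x := by
    intro g b
    rw [integral_const_mul, Measure.integral_comp_smul, finrank_euclideanSpace_fin, hk,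
      abs_of_pos (by positivity), smul_eq_mul]
    field_simp
  have hmass : ∫ x, v x ^ 2 = a ^ 2 := by
    have := hscale (fun x => u x ^ 2) 1
    simp only [mul_one] at this
    simp only [v, mul_pow, this, ← hI]
    field_simp
  have hgrad : ∫ x, ‖gradient v x‖ ^ 2 = a ^ 2 / I * t ^ 2 * B := by
    rw [hB, ← hscale (fun x => ‖gradient u x‖ ^ 2)]
    congr 1 with x
    simp only [v, norm_gradient_eq_norm_fderiv,
      fderiv_const_mul_comp_smul (hu.differentiable (by norm_num)), norm_smul, mul_pow,
      Real.norm_eq_abs, sq_abs]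
  have hlapl : ∫ x, lapl v x ^ 2 = a ^ 2 / I * t ^ 4 * A := by
    rw [hA, ← hscale (fun x => lapl u x ^ 2)]
    congr 1 with x
    simp only [v, lapl_const_mul_comp_smul hu]
    ring
  refine ⟨Emu μ p v, ⟨v, hv, ?_, ?_, ?_, ?_, hmass, by rwa [hlapl], rfl⟩, ?_⟩
  · exact (hv.continuous.pow 2).integrable_of_hasCompactSupport
      hvc.sq
  · exact ((continuous_norm_gradient hv).pow 2).integrable_of_hasCompactSupport
      hvc.norm_gradient.sq
  · exact ((continuous_lapl hv).pow 2).integrable_of_hasCompactSupport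
      hvc.lapl.sq
  · exact (hv.continuous.abs.rpow_const fun _ => Or.inr hp.le).integrable_of_hasCompactSupport
      (hvc.comp_left (g := fun s => |s| ^ p) (by simp [Real.zero_rpow hp.ne']))
  · have hP : 0 ≤ 1 / p * ∫ x, |v x| ^ p :=
      mul_nonneg (by positivity) (integral_nonneg fun x => by positivity)
    have hneg : a ^ 2 / I * t ^ 2 * (t ^ 2 * A - μ * B) < 0 :=
      mul_neg_of_pos_of_neg (by positivity) (by linarith)
    rw [Emu, hgrad, hlapl]
    nlinarith

end

theorem stmt_10 {N : ℕ} (hN : 2 ≤ N) (a μ p γ C R₀ : ℝ)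
    (ha : 0 < a) (hμ : 0 < μ) (hC : 0 < C)
    (hγ : γ = (N : ℝ) * (p - 2) / (4 * p))
    (hp1 : 2 + 8 / (N : ℝ) < p) (hp2 : 5 ≤ N → p < 2 * N / ((N : ℝ) - 4))
    (hGN : ∀ v : EuclideanSpace ℝ (Fin N) → ℝ, ContDiff ℝ 2 v →
      Integrable (fun x => (v x) ^ 2) → Integrable (fun x => ‖gradient v x‖ ^ 2) →
      Integrable (fun x => (lapl v x) ^ 2) → Integrable (fun x => |v x| ^ p) →
      (∫ x, |v x| ^ p) ≤
        C * (∫ x, (v x) ^ 2) ^ (p * (1 - γ) / 2) * (∫ x, (lapl v x) ^ 2) ^ (p * γ / 2))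
    (hsmall : μ ^ (p * γ - 2) * a ^ (p - 2) <
      p / (2 * (p * γ - 1) * C) * ((p * γ - 2) / (p * γ - 1)) ^ (p * γ - 2))
    (hR0 : 0 < R₀)
    (hR0zero : (1 / 2) * R₀ ^ 2 - (μ * a / 2) * R₀ - (C / p) * a ^ (p * (1 - γ)) * R₀ ^ (p * γ) = 0)
    (hR0first : ∀ t : ℝ, 0 < t → t < R₀ →
      (1 / 2) * t ^ 2 - (μ * a / 2) * t - (C / p) * a ^ (p * (1 - γ)) * t ^ (p * γ) < 0) :
    (Vset N a μ p R₀).Nonempty ∧ BddBelow (Vset N a μ p R₀) ∧ sInf (Vset N a μ p R₀) < 0 := by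
  have hN0 : (0 : ℝ) < N := by positivity
  have hp : 2 < p := lt_trans (by linarith [div_pos (by norm_num : (0 : ℝ) < 8) hN0]) hp1
  have hpos : 0 < p := by linarith
  have hpγ : 0 ≤ p * γ / 2 := by
    have : 0 ≤ γ := hγ ▸ div_nonneg (mul_nonneg hN0.le (by linarith)) (by linarith)
    positivity
  have hbdd : BddBelow (Vset N a μ p R₀) := by
    refine ⟨-(μ / 2 * (a ^ 2 + R₀ ^ 2) +
      1 / p * (C * (a ^ 2) ^ (p * (1 - γ) / 2) * (R₀ ^ 2) ^ (p * γ / 2))), ?_⟩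
    rintro _ ⟨v, hv, h0, h1, h2, h3, hmass, hR, rfl⟩
    have hL0 : 0 ≤ ∫ x, lapl v x ^ 2 := integral_nonneg fun x => by positivity
    have hL : ∫ x, lapl v x ^ 2 ≤ R₀ ^ 2 := ((Real.sqrt_lt' hR0).mp hR).le
    have hG := integral_norm_gradient_sq_le hv h0 h1 h2
    have hP := hGN v hv h0 h1 h2 h3
    rw [hmass] at hG hP
    have hP' := hP.trans (mul_le_mul_of_nonneg_left (Real.rpow_le_rpow hL0 hL hpγ)
      (by positivity : 0 ≤ C * (a ^ 2) ^ (p * (1 - γ) / 2)))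
    have e1 := mul_le_mul_of_nonneg_left (hG.trans (add_le_add_right hL _))
      (by positivity : 0 ≤ μ / 2)
    have e2 := mul_le_mul_of_nonneg_left hP' (by positivity : 0 ≤ 1 / p)
    rw [Emu]
    linarith
  obtain ⟨c, hc, hneg⟩ := exists_mem_Vset_neg (by omega : N ≠ 0) ha hμ hpos hR0
  exact ⟨⟨c, hc⟩, hbdd, (csInf_le hbdd hc).trans_lt hneg⟩
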